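/- Let r ≥ 0, T > 0, let χ : [0,T] → [0,1) be C¹ and nonincreasing, and let α : [0,T] → ℝ be C¹ with α'(t) = r·α(t)·(1 − α(t)·(2 − χ(t))) for all t and α(0) = 1/(2 − χ(0)). Then for all t ∈ [0,T]: 1/(2 − χ(t)) ≤ α(t) ≤ 1/(2 − χ(0)) < 1, and α is nonincreasing on [0,T]. -/

import Mathlib

open Set

/-- A positive constant `c` is a lower barrier for `α` on `[0, s]` as soon as `α 0 ≥ c` and `α` does
not decrease at the times at which its value lies in `(0, c]`. -/
theorem le_of_deriv_nonneg_below {α α' : ℝ → ℝ} {c s : ℝ} (hc : 0 < c) (hs : 0 ≤ s)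
    (hα : ∀ t ∈ Icc 0 s, HasDerivWithinAt α (α' t) (Icc 0 s) t) (h0 : c ≤ α 0)
    (hα' : ∀ t ∈ Icc 0 s, 0 < α t → α t ≤ c → 0 ≤ α' t) : c ≤ α s := by
  by_contra! hlt
  obtain ⟨m, hm, hmc⟩ := exists_between (max_lt hlt hc)
  obtain ⟨hαm, hm0⟩ := max_lt_iff.1 hm
  set ε := (c - m) / (s + 1)
  have hε0 : 0 < ε := div_pos (by linarith) (by linarith)
  have hεs : ε * (s + 1) = c - m := div_mul_cancel₀ _ (by linarith)
  have key := image_le_of_deriv_right_lt_deriv_boundary (f := fun t ↦ -α t)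
    (f' := fun t ↦ -α' t) (a := 0) (b := s) (B := fun t ↦ -c + ε * (t + 1)) (B' := fun _ ↦ ε)
    (fun t ht ↦ (hα t ht).continuousWithinAt.neg)
    (fun t ht ↦ ((hα t (Ico_subset_Icc_self ht)).mono_of_mem_nhdsWithin
      (Icc_mem_nhdsGE_of_mem ht)).neg)
    (by linarith)
    (fun t ↦ by simpa using (((hasDerivAt_id t).add_const 1).const_mul ε).const_add (-c))
    (fun t ht heq ↦ by
      have h1 : ε * (t + 1) ≤ ε * (s + 1) := by gcongr; exact ht.2.le
      have h2 : 0 < ε * (t + 1) := mul_pos hε0 (by linarith [ht.1])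
      have := hα' t (Ico_subset_Icc_self ht) (by linarith) (by linarith)
      linarith)
    (right_mem_Icc.2 hs)
  linarith

/-- Comparison bounds for the signaling coefficient `α` in the backward
no-feedback system: `α` lies between the myopic benchmark `1/(2 − χ)` and its
initial value `1/(2 − χ(0)) < 1`, and is nonincreasing. -/
theorem stmt_11 (r T : ℝ) (hr : 0 ≤ r) (hT : 0 < T)
    (χ α : ℝ → ℝ)
    (hχC1 : ContDiffOn ℝ 1 χ (Icc 0 T))
    (hχrng : ∀ t ∈ Icc (0:ℝ) T, 0 ≤ χ t ∧ χ t < 1)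
    (hχanti : AntitoneOn χ (Icc 0 T))
    (hαC1 : ContDiffOn ℝ 1 α (Icc 0 T))
    (hαode : ∀ t ∈ Icc (0:ℝ) T,
      HasDerivWithinAt α (r * α t * (1 - α t * (2 - χ t))) (Icc 0 T) t)
    (hα0 : α 0 = 1 / (2 - χ 0)) :
    (∀ t ∈ Icc (0:ℝ) T,
      1 / (2 - χ t) ≤ α t ∧ α t ≤ 1 / (2 - χ 0)) ∧
    1 / (2 - χ 0) < 1 ∧
    AntitoneOn α (Icc 0 T) := by
  have h0 : (0 : ℝ) ∈ Icc 0 T := left_mem_Icc.2 hT.le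
  have hpos : ∀ t ∈ Icc 0 T, 0 < 2 - χ t := fun t ht ↦ by linarith [(hχrng t ht).2]
  have hlow : ∀ s ∈ Icc 0 T, 1 / (2 - χ s) ≤ α s := fun s hs ↦ by
    have hsub : Icc 0 s ⊆ Icc 0 T := Icc_subset_Icc_right hs.2
    refine le_of_deriv_nonneg_below (one_div_pos.2 (hpos s hs)) hs.1
      (fun t ht ↦ (hαode t (hsub ht)).mono hsub) ?_ fun t ht hαpos hαle ↦ ?_
    · rw [hα0]
      exact one_div_le_one_div_of_le (hpos 0 h0) (by linarith [hχanti h0 hs hs.1])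
    · refine mul_nonneg (mul_nonneg hr hαpos.le) (sub_nonneg.2 ?_)
      calc α t * (2 - χ t) ≤ α t * (2 - χ s) := by
            gcongr
            exact hχanti (hsub ht) hs ht.2
        _ ≤ 1 := (le_div_iff₀ (hpos s hs)).1 hαle
  have hanti : AntitoneOn α (Icc 0 T) := by
    refine antitoneOn_of_hasDerivWithinAt_nonpos (convex_Icc 0 T) hαC1.continuousOn
      (fun t ht ↦ (hαode t (interior_subset ht)).mono interior_subset) fun t ht ↦ ?_
    have ht := interior_subset ht
    have hαpos : 0 < α t := (one_div_pos.2 (hpos t ht)).trans_le (hlow t ht)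
    exact mul_nonpos_of_nonneg_of_nonpos (mul_nonneg hr hαpos.le)
      (sub_nonpos.2 ((div_le_iff₀ (hpos t ht)).1 (hlow t ht)))
  refine ⟨fun t ht ↦ ⟨hlow t ht, hα0 ▸ hanti h0 ht ht.1⟩, ?_, hanti⟩
  rw [div_lt_one (hpos 0 h0)]
  linarith [(hχrng 0 h0).2]
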